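/- Let n ≥ 4 and α > log_{n−2}((2n−4)/(n−1)). Then among all trees on n vertices, the path P_n is the unique tree minimizing σ_t^α. -/

import Mathlib

open Finset

/-- The degree of a vertex: the number of its neighbors. -/
noncomputable def deg {n : ℕ} (G : SimpleGraph (Fin n)) (v : Fin n) : ℕ :=
  Nat.card {u | G.Adj v u}

/-- `σ_t^α(G) = Σ_{{u,v}⊆V(G)} |d(u)−d(v)|^α`, summed over unordered pairs of
distinct vertices. -/
noncomputable def sigmaT {n : ℕ} (G : SimpleGraph (Fin n)) (α : ℝ) : ℝ :=
  ∑ i : Fin n, ∑ j ∈ Finset.Ioi i, |((deg G i : ℝ)) - (deg G j : ℝ)| ^ α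

lemma deg_eq_degree {n : ℕ} (G : SimpleGraph (Fin n)) [DecidableRel G.Adj] (v : Fin n) :
    deg G v = G.degree v := by
  rw [← SimpleGraph.card_neighborSet_eq_degree, ← Nat.card_eq_fintype_card]
  rfl

lemma two_mul_sigmaT {n : ℕ} (G : SimpleGraph (Fin n)) {α : ℝ} (hα : α ≠ 0) :
    2 * sigmaT G α = ∑ i : Fin n, ∑ j : Fin n, |(deg G i : ℝ) - (deg G j : ℝ)| ^ α := by
  have h := sum_sum_Ioi_add_eq_sum_sum_off_diag
    (fun i j : Fin n => |(deg G i : ℝ) - (deg G j : ℝ)| ^ α)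
  have hdiag : ∀ i : Fin n, ∑ j ∈ ({i}ᶜ : Finset (Fin n)), |(deg G j : ℝ) - (deg G i : ℝ)| ^ α
      = ∑ j : Fin n, |(deg G i : ℝ) - (deg G j : ℝ)| ^ α := by
    intro i
    rw [← Finset.sum_add_sum_compl {i} (fun j => |(deg G i : ℝ) - (deg G j : ℝ)| ^ α)]
    simp [Real.zero_rpow hα, abs_sub_comm]
  simp_rw [hdiag] at h
  rw [← h, sigmaT, Finset.mul_sum]
  refine Finset.sum_congr rfl fun i _ => ?_
  rw [Finset.mul_sum]
  refine Finset.sum_congr rfl fun j _ => ?_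
  rw [abs_sub_comm (deg G j : ℝ)]
  ring

lemma sigmaT_congr {n : ℕ} {G H : SimpleGraph (Fin n)} (e : G ≃g H) {α : ℝ} (hα : α ≠ 0) :
    sigmaT G α = sigmaT H α := by
  have hdeg : ∀ v, deg G v = deg H (e v) := fun v => Nat.card_congr (e.mapNeighborSet v)
  refine mul_left_cancel₀ (two_ne_zero (α := ℝ)) ?_
  rw [two_mul_sigmaT G hα, two_mul_sigmaT H hα]
  simp_rw [hdeg]
  refine Fintype.sum_equiv e.toEquiv _ _ fun i => ?_
  exact Fintype.sum_equiv e.toEquiv _ _ fun j => rfl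

/-- The leaves contribute to `σ_t^α` only through pairs consisting of a leaf and a non-leaf. -/
lemma sigmaT_eq_leaf_add {n : ℕ} (G : SimpleGraph (Fin n)) {α : ℝ} (hα : α ≠ 0) :
    sigmaT G α =
      #{v | deg G v = 1} * ∑ j with deg G j ≠ 1, |1 - (deg G j : ℝ)| ^ α +
        (∑ i with deg G i ≠ 1, ∑ j with deg G j ≠ 1, |(deg G i : ℝ) - (deg G j : ℝ)| ^ α) / 2 := by
  have h := two_mul_sigmaT G hα
  have hsplit : ∀ f : Fin n → ℝ,
      ∑ j, f j = ∑ j with deg G j = 1, f j + ∑ j with deg G j ≠ 1, f j := fun f =>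
    (Finset.sum_filter_add_sum_filter_not univ (fun j => deg G j = 1) f).symm
  have hl : ∀ i ∈ ({v | deg G v = 1} : Finset (Fin n)),
      ∑ j, |(deg G i : ℝ) - (deg G j : ℝ)| ^ α =
        ∑ j with deg G j ≠ 1, |1 - (deg G j : ℝ)| ^ α := by
    intro i hi
    rw [Finset.mem_filter] at hi
    rw [hsplit, hi.2, Finset.sum_eq_zero, zero_add, Nat.cast_one]
    intro j hj
    rw [Finset.mem_filter] at hj
    simp [hj.2, Real.zero_rpow hα]
  have hr : ∀ i : Fin n, ∑ j with deg G j = 1, |(deg G i : ℝ) - (deg G j : ℝ)| ^ α =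
      #{v | deg G v = 1} * |1 - (deg G i : ℝ)| ^ α := by
    intro i
    rw [← nsmul_eq_mul]
    refine Finset.sum_eq_card_nsmul fun j hj => ?_
    rw [Finset.mem_filter] at hj
    rw [hj.2, abs_sub_comm, Nat.cast_one]
  rw [hsplit, Finset.sum_congr rfl hl, Finset.sum_const, nsmul_eq_mul] at h
  simp_rw [fun i => hsplit (fun j => |(deg G i : ℝ) - (deg G j : ℝ)| ^ α), hr] at h
  rw [Finset.sum_add_distrib, ← Finset.mul_sum] at h
  linarith

lemma card_leaf_mul_sum_le_sigmaT {n : ℕ} (G : SimpleGraph (Fin n)) {α : ℝ} (hα : α ≠ 0) :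
    #{v | deg G v = 1} * ∑ j with deg G j ≠ 1, |1 - (deg G j : ℝ)| ^ α ≤ sigmaT G α := by
  rw [sigmaT_eq_leaf_add G hα]
  have : 0 ≤ ∑ i with deg G i ≠ 1, ∑ j with deg G j ≠ 1,
      |(deg G i : ℝ) - (deg G j : ℝ)| ^ α := by positivity
  linarith

lemma deg_pathGraph {n : ℕ} (hn : 2 ≤ n) (i : Fin n) :
    deg (SimpleGraph.pathGraph n) i = if i.val = 0 ∨ i.val + 1 = n then 1 else 2 := by
  change Set.ncard _ = _
  have hi := i.isLt
  split_ifs with h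
  · rw [Set.ncard_eq_one]
    rcases h with h | h
    · refine ⟨⟨1, by omega⟩, Set.ext fun u => ?_⟩
      simp only [Set.mem_ofPred_eq, SimpleGraph.pathGraph_adj, Set.mem_singleton_iff, Fin.ext_iff]
      omega
    · refine ⟨⟨n - 2, by omega⟩, Set.ext fun u => ?_⟩
      have hu := u.isLt
      simp only [Set.mem_ofPred_eq, SimpleGraph.pathGraph_adj, Set.mem_singleton_iff, Fin.ext_iff]
      omega
  · rw [Set.ncard_eq_two]
    refine ⟨⟨i.val - 1, by omega⟩, ⟨i.val + 1, by omega⟩, by simp [Fin.ext_iff],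
      Set.ext fun u => ?_⟩
    simp only [Set.mem_ofPred_eq, SimpleGraph.pathGraph_adj, Set.mem_singleton_iff,
      Set.mem_insert_iff, Fin.ext_iff]
    omega

lemma sigmaT_pathGraph {n : ℕ} (hn : 2 ≤ n) {α : ℝ} (hα : α ≠ 0) :
    sigmaT (SimpleGraph.pathGraph n) α = 2 * (n : ℝ) - 4 := by
  have hL : #{v | deg (SimpleGraph.pathGraph n) v = 1} = 2 := by
    rw [Finset.card_eq_two]
    refine ⟨⟨0, by omega⟩, ⟨n - 1, by omega⟩, by simp [Fin.ext_iff]; omega, ?_⟩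
    ext i
    rw [Finset.mem_filter, deg_pathGraph hn]
    simp only [Finset.mem_univ, true_and, Finset.mem_insert, Finset.mem_singleton, Fin.ext_iff]
    split_ifs <;> omega
  have hI : ∀ j ∈ ({v | deg (SimpleGraph.pathGraph n) v ≠ 1} : Finset (Fin n)),
      deg (SimpleGraph.pathGraph n) j = 2 := by
    intro j hj
    rw [Finset.mem_filter] at hj
    have := deg_pathGraph hn j
    split_ifs at this
    · exact absurd this hj.2
    · exact this
  have hcard : (#{v | deg (SimpleGraph.pathGraph n) v ≠ 1} : ℝ) = n - 2 := by
    have := Finset.card_filter_add_card_filter_not (s := (univ : Finset (Fin n)))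
      (fun v => deg (SimpleGraph.pathGraph n) v = 1)
    rw [hL, Finset.card_univ, Fintype.card_fin] at this
    have hR : (2 : ℝ) + #{v | deg (SimpleGraph.pathGraph n) v ≠ 1} = n := by exact_mod_cast this
    linarith
  rw [sigmaT_eq_leaf_add _ hα, hL]
  rw [Finset.sum_congr rfl (g := fun _ => (1 : ℝ)) fun j hj => by rw [hI j hj]; norm_num]
  rw [Finset.sum_eq_zero (f := fun i => ∑ j with deg (SimpleGraph.pathGraph n) j ≠ 1, _)
    fun i hi => Finset.sum_eq_zero fun j hj => by
      rw [hI i hi, hI j hj, sub_self, abs_zero, Real.zero_rpow hα]]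
  rw [Finset.sum_const, nsmul_eq_mul, hcard]
  push_cast
  ring

lemma SimpleGraph.Preconnected.mem_of_adj_closed {V : Type*} {G : SimpleGraph V}
    (hG : G.Preconnected) {s : Set V} (hs : s.Nonempty)
    (h : ∀ x ∈ s, ∀ y, G.Adj x y → y ∈ s) (v : V) : v ∈ s := by
  obtain ⟨u, hu⟩ := hs
  obtain ⟨p⟩ := hG u v
  induction p with
  | nil => exact hu
  | cons hadj p ih => exact ih (h _ hu _ hadj)

/-- A finite nonempty graph has a longest path. -/
lemma SimpleGraph.exists_isPath_forall_length_le {V : Type*} [Fintype V] [Nonempty V]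
    (G : SimpleGraph V) :
    ∃ (u v : V) (p : G.Walk u v), p.IsPath ∧
      ∀ (u' v' : V) (q : G.Walk u' v'), q.IsPath → q.length ≤ p.length := by
  classical
  let P : ℕ → Prop := fun k => ∃ (u v : V) (p : G.Walk u v), p.IsPath ∧ p.length = k
  have h0 : P 0 := ⟨Classical.arbitrary V, _, .nil, .nil, rfl⟩
  obtain ⟨u, v, p, hp, hl⟩ := Nat.findGreatest_spec (P := P) (Nat.zero_le (Fintype.card V)) h0
  refine ⟨u, v, p, hp, fun u' v' q hq => ?_⟩
  rw [hl]
  exact Nat.le_findGreatest hq.length_lt.le ⟨u', v', q, hq, rfl⟩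

/-- In a finite connected graph with all degrees at most two, a longest path visits every
vertex. -/
lemma SimpleGraph.Preconnected.mem_support_of_forall_ncard_le_two {V : Type*} [Finite V]
    {G : SimpleGraph V} (hG : G.Preconnected) (hdeg : ∀ v, (G.neighborSet v).ncard ≤ 2)
    {u v : V} {p : G.Walk u v} (hp : p.IsPath)
    (hmax : ∀ (u' v' : V) (q : G.Walk u' v'), q.IsPath → q.length ≤ p.length) (w : V) :
    w ∈ p.support := by
  refine hG.mem_of_adj_closed (s := {x | x ∈ p.support}) ⟨u, p.start_mem_support⟩ ?_ w
  intro x hx y hxy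
  by_contra hy
  obtain ⟨i, rfl, hi⟩ := SimpleGraph.Walk.mem_support_iff_exists_getVert.mp hx
  rcases Nat.eq_zero_or_pos i with rfl | hpos
  · rw [p.getVert_zero] at hxy
    have := hmax _ _ _ (hp.cons hy (h := hxy.symm))
    simp at this
  rcases hi.eq_or_lt with rfl | hlt
  · rw [p.getVert_length] at hxy
    have := hmax _ _ _ (hp.concat hy hxy)
    simp at this
  have heq : p.toSubgraph.neighborSet (p.getVert i) = G.neighborSet (p.getVert i) := by
    refine Set.eq_of_subset_of_ncard_le (p.toSubgraph.neighborSet_subset _) ?_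
    rw [hp.ncard_neighborSet_toSubgraph_internal_eq_two hpos.ne' hlt]
    exact hdeg _
  have hadj : p.toSubgraph.Adj (p.getVert i) y := by
    change y ∈ p.toSubgraph.neighborSet _
    rw [heq]
    exact hxy
  exact hy ((p.mem_verts_toSubgraph).mp hadj.snd_mem)

/-- A tree with all degrees at most two is a path. -/
lemma SimpleGraph.IsTree.nonempty_iso_pathGraph {n : ℕ} {T : SimpleGraph (Fin n)} (hT : T.IsTree)
    (hdeg : ∀ v, deg T v ≤ 2) : Nonempty (T ≃g SimpleGraph.pathGraph n) := by
  have := hT.connected.nonempty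
  obtain ⟨u, v, p, hp, hmax⟩ := T.exists_isPath_forall_length_le
  have hham : p.IsHamiltonian := hp.isHamiltonian_of_mem
    (hT.connected.preconnected.mem_support_of_forall_ncard_le_two hdeg hp hmax)
  have hlen := hham.length_eq
  rw [Fintype.card_fin] at hlen
  have hinj : Function.Injective fun i : Fin n => p.getVert i := fun i j hij =>
    Fin.ext (hp.getVert_injOn (by simp only [Set.mem_ofPred_eq]; omega)
      (by simp only [Set.mem_ofPred_eq]; omega) hij)
  let e : Fin n ≃ Fin n := Equiv.ofBijective _ (Finite.injective_iff_bijective.mp hinj)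
  have hle : (SimpleGraph.pathGraph n).map e.toEmbedding ≤ T := by
    rw [SimpleGraph.map_le_iff_le_comap]
    intro i j hij
    rw [SimpleGraph.pathGraph_adj] at hij
    change T.Adj (p.getVert i) (p.getVert j)
    rcases hij with h | h
    · rw [← h]
      exact p.adj_getVert_succ (by omega)
    · rw [← h]
      exact (p.adj_getVert_succ (by omega)).symm
  have hconn : ((SimpleGraph.pathGraph n).map e.toEmbedding).Connected :=
    (SimpleGraph.Iso.map e (SimpleGraph.pathGraph n)).connected_iff.mp
      { preconnected := SimpleGraph.pathGraph_preconnected n }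
  have heq : (SimpleGraph.pathGraph n).map e.toEmbedding = T :=
    le_antisymm hle ((SimpleGraph.isTree_iff_minimal_connected.mp hT).2 hconn hle)
  rw [← heq]
  exact ⟨(SimpleGraph.Iso.map e (SimpleGraph.pathGraph n)).symm⟩

lemma SimpleGraph.IsTree.sum_deg {n : ℕ} {T : SimpleGraph (Fin n)} (hT : T.IsTree) :
    ∑ v, deg T v + 2 = 2 * n := by
  classical
  have h1 := T.sum_degrees_eq_twice_card_edges
  have h2 := hT.card_edgeFinset
  rw [Fintype.card_fin] at h2
  simp_rw [deg_eq_degree, h1]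
  omega

lemma SimpleGraph.IsTree.one_le_deg {n : ℕ} (hn : 2 ≤ n) {T : SimpleGraph (Fin n)}
    (hT : T.IsTree) (v : Fin n) : 1 ≤ deg T v := by
  classical
  have : Nontrivial (Fin n) := Fin.nontrivial_iff_two_le.mpr hn
  rw [deg_eq_degree]
  exact hT.connected.preconnected.degree_pos_of_nontrivial v

/-- A tree with a vertex of degree at least three satisfies `σ_t^α > 2n - 4`. -/
lemma SimpleGraph.IsTree.lt_sigmaT {n : ℕ} (hn : 4 ≤ n) {α : ℝ} (hα : 0 < α)
    (hstar : 2 * (n : ℝ) - 4 < (n - 1) * ((n : ℝ) - 2) ^ α)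
    {T : SimpleGraph (Fin n)} (hT : T.IsTree) {w : Fin n} (hw : 3 ≤ deg T w) :
    2 * (n : ℝ) - 4 < sigmaT T α := by
  refine lt_of_lt_of_le ?_ (card_leaf_mul_sum_le_sigmaT T hα.ne')
  have hpos := hT.one_le_deg (by omega)
  have hsum := hT.sum_deg
  have hcard := Finset.card_filter_add_card_filter_not (s := (univ : Finset (Fin n)))
    (fun v => deg T v = 1)
  rw [Finset.card_univ, Fintype.card_fin] at hcard
  rw [← Finset.sum_filter_add_sum_filter_not univ (fun v => deg T v = 1),
    Finset.sum_congr rfl (g := fun _ => 1) fun v hv => (Finset.mem_filter.mp hv).2,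
    Finset.sum_const, smul_eq_mul, mul_one] at hsum
  set L := #{v | deg T v = 1}
  set I : Finset (Fin n) := {v | deg T v ≠ 1}
  have hge : ∀ j ∈ I, 2 ≤ deg T j := fun j hj => by
    have h1 := hpos j
    have h2 := (Finset.mem_filter.mp hj).2
    omega
  have hwI : w ∈ I := Finset.mem_filter.mpr ⟨Finset.mem_univ _, by omega⟩
  have hlt : #I * 2 < ∑ j ∈ I, deg T j := by
    rw [← smul_eq_mul, ← Finset.sum_const]
    exact Finset.sum_lt_sum hge ⟨w, hwI, by omega⟩
  change L + #I = n at hcard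
  change L + ∑ j ∈ I, deg T j + 2 = 2 * n at hsum
  have hIpos : 0 < #I := Finset.card_pos.mpr ⟨w, hwI⟩
  have hcardR : (L : ℝ) + #I = n := by exact_mod_cast hcard
  have habs : ∀ j ∈ I, |1 - (deg T j : ℝ)| = deg T j - 1 := fun j hj => by
    have : (2 : ℝ) ≤ deg T j := by exact_mod_cast hge j hj
    rw [abs_sub_comm, abs_of_nonneg (by linarith)]
  rw [Finset.sum_congr rfl fun j hj => by rw [habs j hj]]
  rcases Nat.lt_or_ge 1 #I with h2 | h1
  · have hlt' : (#I : ℝ) < ∑ j ∈ I, ((deg T j : ℝ) - 1) ^ α := by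
      have : (#I : ℝ) = ∑ j ∈ I, (1 : ℝ) := by simp
      rw [this]
      refine Finset.sum_lt_sum (fun j hj => ?_) ⟨w, hwI, ?_⟩
      · have : (2 : ℝ) ≤ deg T j := by exact_mod_cast hge j hj
        exact Real.one_le_rpow (by linarith) hα.le
      · have : (3 : ℝ) ≤ deg T w := by exact_mod_cast hw
        exact Real.one_lt_rpow (by linarith) hα
    have hL : (3 : ℝ) ≤ L := by exact_mod_cast (by omega : 3 ≤ L)
    have h2' : (2 : ℝ) ≤ #I := by exact_mod_cast h2
    nlinarith
  · obtain ⟨x, hx⟩ := Finset.card_eq_one.mp (by omega : #I = 1)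
    rw [hx, Finset.sum_singleton] at hsum ⊢
    rw [hx, Finset.card_singleton] at hcard hcardR
    have hd : deg T x + 1 = n := by omega
    have hdR : (deg T x : ℝ) - 1 = n - 2 := by
      have : (deg T x : ℝ) + 1 = n := by exact_mod_cast hd
      linarith
    have hLR : (L : ℝ) = n - 1 := by
      rw [Nat.cast_one] at hcardR
      linarith
    rw [hdR, hLR]
    exact hstar

/-- Let `n ≥ 4` and `α > log_{n−2}((2n−4)/(n−1))`. Among all trees on `n`
vertices, the path `P_n` is the unique (up to isomorphism) tree minimizing
`σ_t^α`. -/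
theorem stmt_13 (n : ℕ) (hn : 4 ≤ n) (α : ℝ)
    (hα : Real.logb ((n : ℝ) - 2) ((2 * (n : ℝ) - 4) / ((n : ℝ) - 1)) < α)
    (T : SimpleGraph (Fin n)) (hT : T.IsTree) :
    sigmaT (SimpleGraph.pathGraph n) α ≤ sigmaT T α ∧
      (sigmaT T α = sigmaT (SimpleGraph.pathGraph n) α →
        Nonempty (T ≃g SimpleGraph.pathGraph n)) := by
  have hnR : (4 : ℝ) ≤ n := by exact_mod_cast hn
  have hpos : 0 < α := by
    refine lt_trans (Real.logb_pos (by linarith) ?_) hα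
    rw [one_lt_div (by linarith)]
    linarith
  have hstar : 2 * (n : ℝ) - 4 < (n - 1) * ((n : ℝ) - 2) ^ α := by
    rw [Real.logb_lt_iff_lt_rpow (by linarith) (div_pos (by linarith) (by linarith)),
      div_lt_iff₀ (by linarith)] at hα
    linarith
  by_cases h : ∀ v, deg T v ≤ 2
  · obtain ⟨e⟩ := hT.nonempty_iso_pathGraph h
    exact ⟨(sigmaT_congr e hpos.ne').ge, fun _ => ⟨e⟩⟩
  · rw [sigmaT_pathGraph (by omega) hpos.ne']
    push Not at h
    obtain ⟨w, hw⟩ := h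
    have hlt := hT.lt_sigmaT hn hpos hstar hw
    exact ⟨hlt.le, fun h => absurd h hlt.ne'⟩
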